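/- For every positive integer n, |NCL(n)| = Σ_{β ∈ NC(n)} ∏_{W block of β} Cat_{|W|−1}. -/

import Mathlib

open scoped Classical

/-- The minimum of a finset of naturals (`0` if empty). -/
noncomputable def fmin (A : Finset ℕ) : ℕ := sInf (A : Set ℕ)

/-- The maximum of a finset of naturals (`0` if empty). -/
noncomputable def fmax (A : Finset ℕ) : ℕ := sSup (A : Set ℕ)

/-- `α` is a partition of the finite set `F ⊆ ℕ`. -/
def IsPartitionOfSet (F : Finset ℕ) (α : Finset (Finset ℕ)) : Prop :=
  (∀ V ∈ α, V.Nonempty) ∧ (∀ V ∈ α, V ⊆ F) ∧ (∀ m ∈ F, ∃ V ∈ α, m ∈ V) ∧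
    ∀ V ∈ α, ∀ W ∈ α, V ≠ W → V ∩ W = ∅

/-- `α` is a partition of `{1,…,n}`. -/
def IsPartitionOf (n : ℕ) (α : Finset (Finset ℕ)) : Prop :=
  IsPartitionOfSet (Finset.Icc 1 n) α

/-- Two distinct blocks of the family `π` cross: there are `a < b < c < d` with
`a, c` in one block and `b, d` in a different block. -/
def IsCrossing (π : Finset (Finset ℕ)) : Prop :=
  ∃ A ∈ π, ∃ B ∈ π, A ≠ B ∧
    ∃ a ∈ A, ∃ b ∈ B, ∃ c ∈ A, ∃ d ∈ B, a < b ∧ b < c ∧ c < d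

/-- `α ∈ NC(n)`: a non-crossing partition of `{1,…,n}`. -/
def IsNCPartition (n : ℕ) (α : Finset (Finset ℕ)) : Prop :=
  IsPartitionOf n α ∧ ¬ IsCrossing α

/-- Reverse refinement order `α ≤ β`: every block of `α` is contained in a block of `β`
(equivalently, every block of `β` is a union of blocks of `α`). -/
def Refines (α β : Finset (Finset ℕ)) : Prop := ∀ V ∈ α, ∃ W ∈ β, V ⊆ W

/-- The partial order `α ≪ β`: `α ≤ β` and for every block `W` of `β` there is a block
`V` of `α` containing both `min W` and `max W`. -/
def LL (α β : Finset (Finset ℕ)) : Prop :=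
  Refines α β ∧ ∀ W ∈ β, ∃ V ∈ α, fmin W ∈ V ∧ fmax W ∈ V

/-- A block `V` (of `α`) is `β`-special: some block `W` of `β` has the same min and max. -/
def SpecialBlock (β : Finset (Finset ℕ)) (V : Finset ℕ) : Prop :=
  ∃ W ∈ β, fmin V = fmin W ∧ fmax V = fmax W

/-- `V` is an outer block of `α`: no block of `α` strictly nests around it. -/
def OuterBlock (α : Finset (Finset ℕ)) (V : Finset ℕ) : Prop :=
  ∀ V' ∈ α, ¬ (fmin V' < fmin V ∧ fmax V < fmax V')

/-- `π` is a linked partition of the finite set `F ⊆ ℕ`. -/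
def IsLinkedPartitionOfSet (F : Finset ℕ) (π : Finset (Finset ℕ)) : Prop :=
  (∀ A ∈ π, A.Nonempty) ∧ (∀ A ∈ π, A ⊆ F) ∧ (∀ m ∈ F, ∃ A ∈ π, m ∈ A) ∧
    ∀ A ∈ π, ∀ B ∈ π, A ≠ B →
      A ∩ B = ∅ ∨
        (2 ≤ A.card ∧ 2 ≤ B.card ∧ (A ∩ B).card = 1 ∧ fmin A ≠ fmin B ∧
          ∀ x ∈ A ∩ B, x = fmin A ∨ x = fmin B)

/-- `π ∈ NCL(F)`: a non-crossing linked partition of the finite set `F`. -/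
def IsNCLOfSet (F : Finset ℕ) (π : Finset (Finset ℕ)) : Prop :=
  IsLinkedPartitionOfSet F π ∧ ¬ IsCrossing π

/-- `π ∈ NCL(n)`: a non-crossing linked partition of `{1,…,n}`. -/
def IsNCL (n : ℕ) (π : Finset (Finset ℕ)) : Prop :=
  IsNCLOfSet (Finset.Icc 1 n) π

/-- The number of blocks of `π` containing `m`. -/
noncomputable def coverCount (π : Finset (Finset ℕ)) (m : ℕ) : ℕ :=
  (π.filter fun A => m ∈ A).card

/-- `m` is singly-covered by `π`: it lies in exactly one block. -/
def SinglyCovered (π : Finset (Finset ℕ)) (m : ℕ) : Prop := coverCount π m = 1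

/-- `m` is doubly-covered by `π`: it lies in exactly two blocks. -/
def DoublyCovered (π : Finset (Finset ℕ)) (m : ℕ) : Prop := coverCount π m = 2

/-- The partition `π̂` generated by the blocks of `π`: its blocks are the connected
components of the ground set under the relation of lying in a common block of `π`. -/
noncomputable def genPart (π : Finset (Finset ℕ)) : Finset (Finset ℕ) :=
  (π.sup id).image fun m =>
    (π.sup id).filter fun x =>
      Relation.EqvGen (fun a b => ∃ A ∈ π, a ∈ A ∧ b ∈ A) m x

/-- The unlinking `π̌` of a linked partition `π`. -/
noncomputable def unlink (π : Finset (Finset ℕ)) : Finset (Finset ℕ) :=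
  π.image fun A => if SinglyCovered π (fmin A) then A else A.erase (fmin A)

/-- The block of `α` containing `m` (empty if there is none). -/
noncomputable def blockOf (α : Finset (Finset ℕ)) (m : ℕ) : Finset ℕ :=
  (α.filter fun V => m ∈ V).sup id

/-- The successor of `m` in the cycle on the block `V` (elements in increasing order). -/
noncomputable def nextInBlock (V : Finset ℕ) (m : ℕ) : ℕ :=
  if m = fmax V then fmin V else fmin (V.filter fun x => m < x)

/-- The predecessor of `m` in the cycle on the block `V`. -/
noncomputable def prevInBlock (V : Finset ℕ) (m : ℕ) : ℕ :=
  if m = fmin V then fmax V else fmax (V.filter fun x => x < m)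

/-- The permutation `P_α` associated to a partition `α`, as a function: each block
`{i₁ < i₂ < ⋯ < iₘ}` becomes the cycle `i₁ ↦ i₂ ↦ ⋯ ↦ iₘ ↦ i₁`. -/
noncomputable def permOf (α : Finset (Finset ℕ)) (m : ℕ) : ℕ :=
  if m ∈ blockOf α m then nextInBlock (blockOf α m) m else m

/-- The inverse permutation `P_α⁻¹`, as a function. -/
noncomputable def permOfInv (α : Finset (Finset ℕ)) (m : ℕ) : ℕ :=
  if m ∈ blockOf α m then prevInBlock (blockOf α m) m else m

/-- The action `τ·α` of a map `τ` on a partition `α = {V₁,…,V_p}`, giving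
`{τ(V₁),…,τ(V_p)}`. -/
def mapPart (τ : ℕ → ℕ) (α : Finset (Finset ℕ)) : Finset (Finset ℕ) :=
  α.image fun V => V.image τ

/-- The cycled unlinking `π° := P_{π̂}⁻¹ · π̌`. -/
noncomputable def cycUnlink (π : Finset (Finset ℕ)) : Finset (Finset ℕ) :=
  mapPart (permOfInv (genPart π)) (unlink π)

/-- `NC(n)` as a finset. -/
noncomputable def NCF (n : ℕ) : Finset (Finset (Finset ℕ)) :=
  ((Finset.Icc 1 n).powerset.powerset).filter (IsNCPartition n)

/-- `NCL(n)` as a finset. -/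
noncomputable def NCLF (n : ℕ) : Finset (Finset (Finset ℕ)) :=
  ((Finset.Icc 1 n).powerset.powerset).filter (IsNCL n)

/-- The restriction `π|_E`: the blocks of `π` contained in `E`. -/
def restrictL (π : Finset (Finset ℕ)) (E : Finset ℕ) : Finset (Finset ℕ) :=
  π.filter fun A => A ⊆ E

/-- The partition `β₀` obtained from `β` by leaving blocks of size `≤ 2` intact and
breaking each block `W` with `|W| ≥ 3` into the doubleton `{min W, max W}` together
with `|W| - 2` singletons. -/
noncomputable def breakBlocks (β : Finset (Finset ℕ)) : Finset (Finset ℕ) :=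
  β.biUnion fun W =>
    if W.card ≤ 2 then {W}
    else insert {fmin W, fmax W} ((W \ {fmin W, fmax W}).image fun x => ({x} : Finset ℕ))


/-! ### Connected parent functions on a finite set -/

/-- `p` is a connected non-crossing parent function on `W`. -/
def ConnOn (W : Finset ℕ) (p : ℕ → ℕ) : Prop :=
  (∀ m ∈ W, p m ∈ W ∧ p m ≤ m ∧ (p m = m → ∀ x ∈ W, m ≤ x)) ∧
    ∀ x ∈ W, ∀ y ∈ W, x < y → ¬ (p x < p y ∧ p y < x)

theorem finite_fun (F : Finset ℕ) :
    {p : ℕ → ℕ | (∀ m ∉ F, p m = m) ∧ ∀ m ∈ F, p m ≤ m}.Finite := by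
  rw [← Set.finite_coe_iff]
  refine Finite.of_injective
    (β := (m : F) → Fin (m.1 + 1))
    (fun p m => ⟨p.1 m.1, Nat.lt_succ_of_le (p.2.2 m.1 m.2)⟩) ?_
  rintro ⟨p, hp⟩ ⟨q, hq⟩ h
  apply Subtype.ext
  funext m
  by_cases hm : m ∈ F
  · have := congrFun h ⟨m, hm⟩
    simpa using this
  · show p m = q m
    rw [hp.1 m hm, hq.1 m hm]

/-- All functions below the identity on `F` and equal to the identity off `F`. -/
noncomputable def allFun (F : Finset ℕ) : Finset (ℕ → ℕ) := (finite_fun F).toFinset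

theorem mem_allFun {F : Finset ℕ} {p : ℕ → ℕ} :
    p ∈ allFun F ↔ (∀ m ∉ F, p m = m) ∧ ∀ m ∈ F, p m ≤ m := by
  simp [allFun]

/-- Connected parent functions. -/
noncomputable def CF (W : Finset ℕ) : Finset (ℕ → ℕ) := (allFun W).filter (ConnOn W)

theorem mem_CF {W : Finset ℕ} {p : ℕ → ℕ} :
    p ∈ CF W ↔ (∀ m ∉ W, p m = m) ∧ ConnOn W p := by
  simp only [CF, Finset.mem_filter, mem_allFun]
  constructor
  · rintro ⟨⟨h, _⟩, h2⟩
    exact ⟨h, h2⟩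
  · rintro ⟨h, h2⟩
    exact ⟨⟨h, fun m hm => (h2.1 m hm).2.1⟩, h2⟩

theorem sum_rank (W : Finset ℕ) (f : ℕ → ℕ) :
    ∑ j ∈ W, f ((W.filter (· < j)).card) = ∑ i ∈ Finset.range W.card, f i := by
  have hlt : ∀ i ∈ W, ∀ j ∈ W, i < j →
      (W.filter (· < i)).card < (W.filter (· < j)).card := by
    intro i hi j hj hij
    apply Finset.card_lt_card
    refine Finset.ssubset_iff_subset_ne.2 ⟨?_, ?_⟩
    · intro x hx
      simp only [Finset.mem_filter] at hx ⊢
      exact ⟨hx.1, hx.2.trans hij⟩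
    · intro h
      have : i ∈ W.filter (· < j) := by simp [hi, hij]
      rw [← h] at this
      simp at this
  have hinj : Set.InjOn (fun j => (W.filter (· < j)).card) (W : Set ℕ) := by
    intro i hi j hj h
    rcases lt_trichotomy i j with h1 | h1 | h1
    · have := hlt i hi j hj h1
      simp only at h
      omega
    · exact h1
    · have := hlt j hj i hi h1
      simp only at h
      omega
  have himg : W.image (fun j => (W.filter (· < j)).card) = Finset.range W.card := by
    apply Finset.eq_of_subset_of_card_le
    · intro k hk
      simp only [Finset.mem_image, Finset.mem_range] at hk ⊢
      obtain ⟨j, hj, rfl⟩ := hk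
      apply Finset.card_lt_card
      refine Finset.ssubset_iff_subset_ne.2 ⟨Finset.filter_subset _ _, ?_⟩
      intro h
      rw [← h] at hj
      simp at hj
    · rw [Finset.card_image_of_injOn hinj]
      simp
  rw [← himg, Finset.sum_image hinj]

/-- last child of `a`. -/
noncomputable def lastChild (W : Finset ℕ) (a : ℕ) (p : ℕ → ℕ) : ℕ :=
  ((W.erase a).filter fun m => p m = a).sup id

theorem lastChild_eq_iff {W : Finset ℕ} {a j : ℕ} {p : ℕ → ℕ} (hj : j ∈ W.erase a)
    (ha : ∃ m ∈ W.erase a, p m = a) :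
    lastChild W a p = j ↔ p j = a ∧ ∀ m ∈ W.erase a, p m = a → m ≤ j := by
  have hle : ∀ m ∈ W.erase a, p m = a → m ≤ lastChild W a p := by
    intro m hm h
    exact Finset.le_sup (f := id) (Finset.mem_filter.2 ⟨hm, h⟩)
  constructor
  · rintro rfl
    refine ⟨?_, hle⟩
    obtain ⟨m, hm, h⟩ := ha
    obtain ⟨x, hx, hx2⟩ := Finset.exists_mem_eq_sup ((W.erase a).filter fun m => p m = a)
      ⟨m, Finset.mem_filter.2 ⟨hm, h⟩⟩ id
    have : lastChild W a p = x := hx2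
    rw [this]
    exact (Finset.mem_filter.1 hx).2
  · rintro ⟨h1, h2⟩
    apply le_antisymm
    · apply Finset.sup_le
      intro m hm
      rw [Finset.mem_filter] at hm
      exact h2 m hm.1 hm.2
    · exact hle j hj h1

theorem card_split (W : Finset ℕ) (a j : ℕ) (haW : a ∈ W) (hmin : ∀ x ∈ W, a ≤ x)
    (hj : j ∈ W) (haj : a < j) :
    ((CF W).filter fun p => p j = a ∧ ∀ m ∈ W.erase a, p m = a → m ≤ j).card
      = (CF (W.filter (· < j))).card * (CF (W.filter fun x => ¬ x < j)).card := by
  rw [← Finset.card_product]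
  refine Finset.card_nbij'
    (fun p => (fun m => if m < j then p m else m, fun m => if j < m then p m else m))
    (fun q m => if m < j then q.1 m else if m = j then a else q.2 m) ?_ ?_ ?_ ?_
  · intro p hp
    simp only [Finset.coe_filter, Set.mem_ofPred_eq, mem_CF] at hp
    obtain ⟨⟨hoff, hc1, hc2⟩, hpj, hmax⟩ := hp
    have hge : ∀ y ∈ W, j < y → j ≤ p y := by
      intro y hy hjy
      have h1 := hc2 j hj y hy hjy
      have h2 := hmax y (Finset.mem_erase.2 ⟨by omega, hy⟩)
      have h3 := hmin _ (hc1 y hy).1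
      by_contra hcon
      apply h1
      refine ⟨?_, by omega⟩
      rw [hpj]
      rcases Nat.lt_or_ge a (p y) with h | h
      · exact h
      · have := h2 (by omega)
        omega
    simp only [Finset.coe_product, Set.mem_prod, Finset.mem_coe, mem_CF, ConnOn,
      Finset.mem_filter]
    refine ⟨⟨?_, ?_, ?_⟩, ?_, ?_, ?_⟩
    · intro m hm
      split_ifs with h
      · exact hoff m (fun h' => hm ⟨h', h⟩)
      · rfl
    · rintro m ⟨hm, hmj⟩
      have := hc1 m hm
      simp only [hmj, if_true]
      exact ⟨⟨this.1, by omega⟩, this.2.1, fun h x hx => this.2.2 h x hx.1⟩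
    · rintro x ⟨hx, hxj⟩ y ⟨hy, hyj⟩ hxy
      simp only [hxj, hyj, if_true]
      exact hc2 x hx y hy hxy
    · intro m hm
      split_ifs with h
      · exact hoff m (fun h' => hm ⟨h', by omega⟩)
      · rfl
    · rintro m ⟨hm, hmj⟩
      have := hc1 m hm
      split_ifs with h
      · have h2 := hge m hm h
        refine ⟨⟨this.1, by omega⟩, this.2.1, fun h x hx => ?_⟩
        have := this.2.2 h a haW
        omega
      · exact ⟨⟨hm, hmj⟩, le_refl _, fun _ x hx => by omega⟩
    · rintro x ⟨hx, hxj⟩ y ⟨hy, hyj⟩ hxy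
      have h1 := hc2 x hx y hy hxy
      have h2 := hge y hy
      split_ifs <;> omega
  · rintro ⟨q, r⟩ hq
    simp only [Finset.coe_product, Set.mem_prod, Finset.mem_coe, mem_CF, ConnOn,
      Finset.mem_filter] at hq
    obtain ⟨⟨hq0, hq1, hq2⟩, hr0, hr1, hr2⟩ := hq
    have hr1' : ∀ m ∈ W, j < m → r m ∈ W ∧ j ≤ r m ∧ r m < m := by
      intro m hm hjm
      have := hr1 m ⟨hm, by omega⟩
      refine ⟨this.1.1, by omega, ?_⟩
      rcases Nat.lt_or_ge (r m) m with h | h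
      · exact h
      · have := this.2.2 (by omega) j ⟨hj, by omega⟩
        omega
    simp only [Finset.coe_filter, Set.mem_ofPred_eq, mem_CF, ConnOn]
    refine ⟨⟨?_, ?_, ?_⟩, ?_, ?_⟩
    · intro m hm
      split_ifs with h1 h2
      · exact hq0 m (fun h => hm h.1)
      · exact absurd (h2 ▸ hj) hm
      · exact hr0 m (fun h => hm h.1)
    · intro m hm
      split_ifs with h1 h2
      · have := hq1 m ⟨hm, h1⟩
        refine ⟨this.1.1, this.2.1, fun h x hx => ?_⟩
        have := this.2.2 h a ⟨haW, haj⟩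
        have := hmin x hx
        omega
      · exact ⟨haW, by omega, fun h => by omega⟩
      · have := hr1' m hm (by omega)
        exact ⟨this.1, by omega, fun h => by omega⟩
    · intro x hx y hy hxy
      have A1 := fun h => hq1 x ⟨hx, h⟩
      have A2 := fun h => hq1 y ⟨hy, h⟩
      have A3 := fun h h' => hq2 x ⟨hx, h⟩ y ⟨hy, h'⟩ hxy
      have B1 := hr1' x hx
      have B2 := hr1' y hy
      have B3 := fun h h' => hr2 x ⟨hx, h⟩ y ⟨hy, h'⟩ hxy
      have C := fun h => hmin _ (A1 h).1.1
      split_ifs with h1 h2 h3 h4 h5 h6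
      all_goals first
        | exact A3 h1 h2
        | exact B3 ‹_› ‹_›
        | skip
      all_goals rintro ⟨h7, h8⟩
      all_goals omega
    · simp
    · intro m hm h
      rw [Finset.mem_erase] at hm
      by_contra hcon
      have := hr1' m hm.2 (by omega)
      rw [if_neg (by omega), if_neg (by omega)] at h
      omega
  · intro p hp
    simp only [Finset.coe_filter, Set.mem_ofPred_eq, mem_CF] at hp
    funext m
    simp only
    split_ifs with h1 h2 h3
    · rfl
    · rw [h2, hp.2.1]
    · rfl
    · omega
  · rintro ⟨q, r⟩ hq
    simp only [Finset.coe_product, Set.mem_prod, Finset.mem_coe, mem_CF, ConnOn,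
      Finset.mem_filter] at hq
    obtain ⟨⟨hq0, hq1, hq2⟩, hr0, hr1, hr2⟩ := hq
    apply Prod.ext
    · funext m
      simp only
      split_ifs with h1
      · rfl
      · exact (hq0 m (fun h => h1 h.2)).symm
    · funext m
      simp only
      split_ifs with h1 h2 h3
      · omega
      · omega
      · rfl
      · by_cases hm : m ∈ W ∧ ¬ m < j
        · have := hr1 m hm
          omega
        · exact (hr0 m hm).symm

theorem card_CF : ∀ (k : ℕ) (W : Finset ℕ), W.card = k + 1 → (CF W).card = catalan k := by
  intro k
  induction k using Nat.strong_induction_on with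
  | _ k ih =>
  intro W hW
  have hne : W.Nonempty := Finset.card_pos.1 (by omega)
  obtain ⟨a, haW, hmin⟩ : ∃ a ∈ W, ∀ x ∈ W, a ≤ x :=
    ⟨W.min' hne, W.min'_mem hne, fun x hx => W.min'_le x hx⟩
  rcases k with _ | k
  · obtain ⟨b, rfl⟩ := Finset.card_eq_one.1 hW
    have : CF {b} = {id} := by
      ext p
      simp only [mem_CF, ConnOn, Finset.mem_singleton]
      constructor
      · rintro ⟨h1, h2, -⟩
        funext m
        by_cases hm : m = b
        · rw [hm]
          exact (h2 b rfl).1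
        · exact h1 m hm
      · rintro rfl
        simp
    rw [this]
    simp
  · have hchild : ∀ p ∈ CF W, ∃ m ∈ W.erase a, p m = a := by
      intro p hp
      rw [mem_CF] at hp
      have hne2 : (W.erase a).Nonempty := Finset.card_pos.1 (by
        rw [Finset.card_erase_of_mem haW]; omega)
      have hm := (W.erase a).min'_mem hne2
      refine ⟨_, hm, ?_⟩
      set b := (W.erase a).min' hne2
      have hbW := (Finset.mem_erase.1 hm).2
      have hba := (Finset.mem_erase.1 hm).1
      have h1 := hp.2.1 b hbW
      by_contra hcon
      have h2 : b ≤ p b := (W.erase a).min'_le _ (Finset.mem_erase.2 ⟨hcon, h1.1⟩)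
      have := h1.2.2 (by omega) a haW
      have := hmin b hbW
      omega
    have hmap : ∀ p ∈ CF W, lastChild W a p ∈ W.erase a := by
      intro p hp
      obtain ⟨m, hm, h⟩ := hchild p hp
      obtain ⟨x, hx, hx2⟩ := Finset.exists_mem_eq_sup ((W.erase a).filter fun m => p m = a)
        ⟨m, Finset.mem_filter.2 ⟨hm, h⟩⟩ id
      have h3 : lastChild W a p = x := hx2
      rw [h3]
      exact (Finset.mem_filter.1 hx).1
    rw [Finset.card_eq_sum_card_fiberwise (f := lastChild W a) (t := W.erase a) hmap]
    have hterm : ∀ j ∈ W.erase a,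
        ((CF W).filter fun p => lastChild W a p = j).card
          = catalan ((W.filter (· < j)).card - 1) * catalan (k + 1 - (W.filter (· < j)).card) := by
      intro j hj
      have hjW := (Finset.mem_erase.1 hj).2
      have haj : a < j := lt_of_le_of_ne (hmin j hjW) (Ne.symm (Finset.mem_erase.1 hj).1)
      rw [Finset.filter_congr (fun p hp => lastChild_eq_iff hj (hchild p hp)),
        card_split W a j haW hmin hjW haj]
      have hsum := Finset.card_filter_add_card_filter_not (s := W) (fun x => x < j)
      have h1 : 0 < (W.filter (· < j)).card :=
        Finset.card_pos.2 ⟨a, Finset.mem_filter.2 ⟨haW, haj⟩⟩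
      have h2 : 0 < (W.filter fun x => ¬ x < j).card :=
        Finset.card_pos.2 ⟨j, Finset.mem_filter.2 ⟨hjW, lt_irrefl j⟩⟩
      rw [ih ((W.filter (· < j)).card - 1) (by omega) _ (by omega),
        ih (k + 1 - (W.filter (· < j)).card) (by omega) _ (by omega)]
    rw [Finset.sum_congr rfl hterm]
    have hall := sum_rank W (fun i => if i = 0 then 0 else catalan (i - 1) * catalan (k + 1 - i))
    rw [← Finset.add_sum_erase W _ haW] at hall
    have h0 : (W.filter (· < a)).card = 0 := by
      rw [Finset.card_eq_zero, Finset.filter_eq_empty_iff]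
      intro x hx
      have := hmin x hx
      omega
    rw [h0, hW, Finset.sum_range_succ'] at hall
    simp only [if_true, zero_add, add_zero] at hall
    rw [catalan_succ', Finset.Nat.sum_antidiagonal_eq_sum_range_succ
      (fun i j => catalan i * catalan j)]
    refine Eq.trans ?_ (hall.trans ?_)
    · apply Finset.sum_congr rfl
      intro j hj
      have hjW := (Finset.mem_erase.1 hj).2
      have haj : a < j := lt_of_le_of_ne (hmin j hjW) (Ne.symm (Finset.mem_erase.1 hj).1)
      have h1 : 0 < (W.filter (· < j)).card :=
        Finset.card_pos.2 ⟨a, Finset.mem_filter.2 ⟨haW, haj⟩⟩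
      rw [if_neg (by omega)]
    · apply Finset.sum_congr rfl
      intro i _
      rw [if_neg (by omega)]
      congr 2
      omega

/-! ### Non-crossing parent functions and their components -/

/-- Non-crossing parent functions on `{1,…,n}`. -/
noncomputable def NFun (n : ℕ) : Finset (ℕ → ℕ) :=
  (allFun (Finset.Icc 1 n)).filter fun p =>
    (∀ m ∈ Finset.Icc 1 n, p m ∈ Finset.Icc 1 n) ∧ ∀ x y, x < y → ¬ (p x < p y ∧ p y < x)

theorem mem_NFun {n : ℕ} {p : ℕ → ℕ} :
    p ∈ NFun n ↔ (∀ m ∉ Finset.Icc 1 n, p m = m) ∧ (∀ m, p m ≤ m) ∧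
      (∀ m ∈ Finset.Icc 1 n, p m ∈ Finset.Icc 1 n) ∧
      ∀ x y, x < y → ¬ (p x < p y ∧ p y < x) := by
  simp only [NFun, Finset.mem_filter, mem_allFun]
  constructor
  · rintro ⟨⟨h1, h2⟩, h3, h4⟩
    refine ⟨h1, fun m => ?_, h3, h4⟩
    by_cases hm : m ∈ Finset.Icc 1 n
    · exact h2 m hm
    · exact (h1 m hm).le
  · rintro ⟨h1, h2, h3, h4⟩
    exact ⟨⟨h1, fun m _ => h2 m⟩, h3, h4⟩

/-- The root of `m` under the parent function `p`. -/
noncomputable def rootOf (p : ℕ → ℕ) (m : ℕ) : ℕ :=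
  if p m < m then rootOf p (p m) else m
termination_by m
decreasing_by assumption

theorem rootOf_lt {p : ℕ → ℕ} {m : ℕ} (h : p m < m) : rootOf p m = rootOf p (p m) := by
  rw [rootOf, if_pos h]

theorem rootOf_ge {p : ℕ → ℕ} {m : ℕ} (h : ¬ p m < m) : rootOf p m = m := by
  rw [rootOf, if_neg h]

theorem rootOf_le (p : ℕ → ℕ) (m : ℕ) : rootOf p m ≤ m := by
  induction m using Nat.strong_induction_on with
  | _ m ih =>
  by_cases h : p m < m
  · rw [rootOf_lt h]
    exact (ih _ h).trans h.le
  · rw [rootOf_ge h]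

theorem rootOf_parent {p : ℕ → ℕ} (hp : ∀ m, p m ≤ m) (m : ℕ) :
    rootOf p (p m) = rootOf p m := by
  by_cases h : p m < m
  · rw [rootOf_lt h]
  · have : p m = m := le_antisymm (hp m) (not_lt.1 h)
    rw [this]

theorem rootOf_fixed {p : ℕ → ℕ} (hp : ∀ m, p m ≤ m) (m : ℕ) :
    p (rootOf p m) = rootOf p m := by
  induction m using Nat.strong_induction_on with
  | _ m ih =>
  by_cases h : p m < m
  · rw [rootOf_lt h]
    exact ih _ h
  · rw [rootOf_ge h]
    exact le_antisymm (hp m) (not_lt.1 h)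

theorem rootOf_root {p : ℕ → ℕ} (hp : ∀ m, p m ≤ m) (m : ℕ) :
    rootOf p (rootOf p m) = rootOf p m := by
  apply rootOf_ge
  rw [rootOf_fixed hp]
  exact lt_irrefl _

theorem exists_step {p : ℕ → ℕ} (s x : ℕ) (h1 : rootOf p x < s) (h2 : s ≤ x) :
    ∃ u, rootOf p u = rootOf p x ∧ p u < s ∧ s ≤ u ∧ u ≤ x := by
  induction x using Nat.strong_induction_on with
  | _ x ih =>
  by_cases h : p x < x
  · by_cases h3 : p x < s
    · exact ⟨x, rfl, h3, h2, le_refl _⟩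
    · rw [rootOf_lt h] at h1 ⊢
      obtain ⟨u, h4, h5, h6, h7⟩ := ih (p x) h h1 (not_lt.1 h3)
      exact ⟨u, h4, h5, h6, h7.trans h.le⟩
  · rw [rootOf_ge h] at h1
    omega

theorem rootOf_nc {p : ℕ → ℕ} (hp : ∀ m, p m ≤ m)
    (hnc : ∀ x y, x < y → ¬ (p x < p y ∧ p y < x)) (x y : ℕ) (hxy : x < y) :
    ¬ (rootOf p x < rootOf p y ∧ rootOf p y < x) := by
  rintro ⟨h1, h2⟩
  obtain ⟨u, hu1, hu2, hu3, hu4⟩ := exists_step (rootOf p y) x h1 h2.le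
  have hne : u ≠ rootOf p y := by
    intro h
    rw [h, rootOf_root hp] at hu1
    omega
  obtain ⟨v, hv1, hv2, hv3, hv4⟩ := exists_step (p := p) u y (by omega) (by omega)
  have hne2 : v ≠ u := by
    rintro rfl
    omega
  have h3 := rootOf_le p (p v)
  rw [rootOf_parent hp] at h3
  exact hnc u v (by omega) ⟨by omega, hv2⟩

/-- The component partition. -/
noncomputable def compPart (n : ℕ) (p : ℕ → ℕ) : Finset (Finset ℕ) :=
  (Finset.Icc 1 n).image fun m => (Finset.Icc 1 n).filter fun x => rootOf p x = rootOf p m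

theorem compPart_mem {n : ℕ} {p : ℕ → ℕ} (hp : p ∈ NFun n) : compPart n p ∈ NCF n := by
  rw [mem_NFun] at hp
  obtain ⟨h1, h2, h3, h4⟩ := hp
  have hsub : ∀ V ∈ compPart n p, V ⊆ Finset.Icc 1 n := by
    intro V hV
    obtain ⟨m, hm, rfl⟩ := Finset.mem_image.1 hV
    exact Finset.filter_subset _ _
  rw [NCF, Finset.mem_filter]
  refine ⟨?_, ⟨?_, hsub, ?_, ?_⟩, ?_⟩
  · rw [Finset.mem_powerset]
    intro V hV
    exact Finset.mem_powerset.2 (hsub V hV)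
  · intro V hV
    obtain ⟨m, hm, rfl⟩ := Finset.mem_image.1 hV
    exact ⟨m, Finset.mem_filter.2 ⟨hm, rfl⟩⟩
  · intro m hm
    exact ⟨_, Finset.mem_image_of_mem _ hm, Finset.mem_filter.2 ⟨hm, rfl⟩⟩
  · intro V hV W hW hne
    obtain ⟨m, hm, rfl⟩ := Finset.mem_image.1 hV
    obtain ⟨m', hm', rfl⟩ := Finset.mem_image.1 hW
    by_contra hcon
    obtain ⟨x, hx⟩ := Finset.nonempty_iff_ne_empty.2 hcon
    simp only [Finset.mem_inter, Finset.mem_filter] at hx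
    apply hne
    rw [← hx.1.2, ← hx.2.2]
  · rintro ⟨V, hV, W, hW, hne, a, ha, b, hb, c, hc, d, hd, hab, hbc, hcd⟩
    obtain ⟨m, hm, rfl⟩ := Finset.mem_image.1 hV
    obtain ⟨m', hm', rfl⟩ := Finset.mem_image.1 hW
    simp only [Finset.mem_filter] at ha hb hc hd
    have hr : rootOf p m ≠ rootOf p m' := by
      intro h
      apply hne
      rw [h]
    have A := rootOf_nc h2 h4 c d hcd
    have B := rootOf_nc h2 h4 b c hbc
    have C := rootOf_le p a
    have D := rootOf_le p b
    omega

theorem ConnOn.congr {W : Finset ℕ} {p q : ℕ → ℕ} (h : ConnOn W p) (hpq : ∀ m ∈ W, q m = p m) :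
    ConnOn W q := by
  refine ⟨fun m hm => ?_, fun x hx y hy hxy => ?_⟩
  · rw [hpq m hm]
    exact h.1 m hm
  · rw [hpq x hx, hpq y hy]
    exact h.2 x hx y hy hxy

theorem ConnOn.root_mem {W : Finset ℕ} {p : ℕ → ℕ} (h : ConnOn W p) (x : ℕ) (hx : x ∈ W) :
    rootOf p x ∈ W := by
  induction x using Nat.strong_induction_on with
  | _ x ih =>
  by_cases h1 : p x < x
  · rw [rootOf_lt h1]
    exact ih _ h1 (h.1 x hx).1
  · rw [rootOf_ge h1]
    exact hx

/-- Parent functions with given components. -/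
noncomputable def fibF (n : ℕ) (β : Finset (Finset ℕ)) : Finset (ℕ → ℕ) :=
  (allFun (Finset.Icc 1 n)).filter fun p => ∀ W ∈ β, ConnOn W p

theorem fiber_eq (n : ℕ) (β : Finset (Finset ℕ)) (hβ : β ∈ NCF n) :
    ((NFun n).filter fun p => compPart n p = β) = fibF n β := by
  rw [NCF, Finset.mem_filter] at hβ
  obtain ⟨-, ⟨hβ1, hβ2, hβ3, hβ4⟩, hβ5⟩ := hβ
  ext p
  simp only [Finset.mem_filter, fibF, mem_NFun, mem_allFun]
  constructor
  · rintro ⟨⟨h1, h2, h3, h4⟩, rfl⟩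
    refine ⟨⟨h1, fun m _ => h2 m⟩, ?_⟩
    intro W hW
    obtain ⟨m₀, hm₀, rfl⟩ := Finset.mem_image.1 hW
    refine ⟨fun m hm => ?_, fun x _ y _ hxy => h4 x y hxy⟩
    rw [Finset.mem_filter] at hm
    refine ⟨Finset.mem_filter.2 ⟨h3 m hm.1, ?_⟩, h2 m, fun h x hx => ?_⟩
    · rw [rootOf_parent h2, hm.2]
    · rw [Finset.mem_filter] at hx
      have h5 : rootOf p m = m := rootOf_ge (by omega)
      have h6 := rootOf_le p x
      omega
  · rintro ⟨⟨h1, h2⟩, h3⟩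
    have hle : ∀ m, p m ≤ m := by
      intro m
      by_cases hm : m ∈ Finset.Icc 1 n
      · exact h2 m hm
      · exact (h1 m hm).le
    have heq : ∀ V ∈ β, ∀ W ∈ β, ∀ x, x ∈ V → x ∈ W → V = W := by
      intro V hV W hW x hxV hxW
      by_contra hne
      have h5 : x ∈ V ∩ W := Finset.mem_inter.2 ⟨hxV, hxW⟩
      rw [hβ4 V hV W hW hne] at h5
      simp at h5
    refine ⟨⟨h1, hle, ?_, ?_⟩, ?_⟩
    · intro m hm
      obtain ⟨W, hW, hmW⟩ := hβ3 m hm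
      exact hβ2 W hW ((h3 W hW).1 m hmW).1
    · rintro x y hxy ⟨h5, h6⟩
      have hx : x ∈ Finset.Icc 1 n := by
        by_contra hx
        have := h1 x hx
        omega
      have hy : y ∈ Finset.Icc 1 n := by
        by_contra hy
        have := h1 y hy
        omega
      obtain ⟨V, hV, hxV⟩ := hβ3 x hx
      obtain ⟨W, hW, hyW⟩ := hβ3 y hy
      by_cases hVW : V = W
      · subst hVW
        exact (h3 V hV).2 x hxV y hyW hxy ⟨h5, h6⟩
      · exact hβ5 ⟨V, hV, W, hW, hVW, p x, ((h3 V hV).1 x hxV).1, p y, ((h3 W hW).1 y hyW).1,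
          x, hxV, y, hyW, h5, h6, hxy⟩
    · have hroot : ∀ W ∈ β, ∀ m ∈ W, ∀ x ∈ W, rootOf p m ≤ x := by
        intro W hW m hm x hx
        exact ((h3 W hW).1 _ ((h3 W hW).root_mem m hm)).2.2 (rootOf_fixed hle m) x hx
      have hcls : ∀ W ∈ β, ∀ m ∈ W,
          ((Finset.Icc 1 n).filter fun x => rootOf p x = rootOf p m) = W := by
        intro W hW m hm
        ext x
        rw [Finset.mem_filter]
        constructor
        · rintro ⟨hx, h5⟩
          obtain ⟨V, hV, hxV⟩ := hβ3 x hx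
          have h6 := (h3 V hV).root_mem x hxV
          have h7 := (h3 W hW).root_mem m hm
          rw [h5] at h6
          rw [← heq V hV W hW _ h6 h7]
          exact hxV
        · intro hx
          refine ⟨hβ2 W hW hx, ?_⟩
          apply le_antisymm
          · exact hroot W hW x hx _ ((h3 W hW).root_mem m hm)
          · exact hroot W hW m hm _ ((h3 W hW).root_mem x hx)
      ext V
      rw [compPart, Finset.mem_image]
      constructor
      · rintro ⟨m, hm, rfl⟩
        obtain ⟨W, hW, hmW⟩ := hβ3 m hm
        rw [hcls W hW m hmW]
        exact hW
      · intro hV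
        obtain ⟨m, hm⟩ := hβ1 V hV
        exact ⟨m, hβ2 V hV hm, hcls V hV m hm⟩

theorem card_fibF (n : ℕ) (β : Finset (Finset ℕ)) (hβ : β ∈ NCF n) :
    (fibF n β).card = ∏ W ∈ β, catalan (W.card - 1) := by
  rw [NCF, Finset.mem_filter] at hβ
  obtain ⟨-, ⟨hβ1, hβ2, hβ3, hβ4⟩, hβ5⟩ := hβ
  have heq : ∀ V ∈ β, ∀ W ∈ β, ∀ x, x ∈ V → x ∈ W → V = W := by
    intro V hV W hW x hxV hxW
    by_contra hne
    have h5 : x ∈ V ∩ W := Finset.mem_inter.2 ⟨hxV, hxW⟩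
    rw [hβ4 V hV W hW hne] at h5
    simp at h5
  have h1 : ∏ W ∈ β, catalan (W.card - 1) = ∏ W ∈ β, (CF W).card := by
    apply Finset.prod_congr rfl
    intro W hW
    have := Finset.card_pos.2 (hβ1 W hW)
    rw [card_CF (W.card - 1) W (by omega)]
  rw [h1, ← Finset.card_pi]
  let glue : ((W : Finset ℕ) → W ∈ β → ℕ → ℕ) → ℕ → ℕ := fun f m =>
    if h : ∃ W, ∃ _ : W ∈ β, m ∈ W then f h.choose h.choose_spec.choose m else m
  have hglue : ∀ f W (hW : W ∈ β) m, m ∈ W → glue f m = f W hW m := by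
    intro f W hW m hm
    have h : ∃ W, ∃ _ : W ∈ β, m ∈ W := ⟨W, hW, hm⟩
    have hg : glue f m = f h.choose h.choose_spec.choose m := dif_pos h
    rw [hg]
    have h2 : h.choose = W := heq _ h.choose_spec.choose W hW m h.choose_spec.choose_spec hm
    have h3 : ∀ V (hV : V ∈ β), V = W → f V hV m = f W hW m := by
      rintro V hV rfl
      rfl
    exact h3 _ _ h2
  have hglue2 : ∀ f m, m ∉ Finset.Icc 1 n → glue f m = m := by
    intro f m hm
    apply dif_neg
    rintro ⟨W, hW, hmW⟩
    exact hm (hβ2 W hW hmW)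
  refine Finset.card_bij' (fun p _ => fun W _ m => if m ∈ W then p m else m)
    (fun f _ => glue f) ?_ ?_ ?_ ?_
  · intro p hp
    rw [fibF, Finset.mem_filter] at hp
    rw [Finset.mem_pi]
    intro W hW
    rw [mem_CF]
    refine ⟨fun m hm => if_neg hm, (hp.2 W hW).congr fun m hm => if_pos hm⟩
  · intro f hf
    rw [Finset.mem_pi] at hf
    rw [fibF, Finset.mem_filter, mem_allFun]
    refine ⟨⟨hglue2 f, ?_⟩, ?_⟩
    · intro m hm
      obtain ⟨W, hW, hmW⟩ := hβ3 m hm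
      rw [hglue f W hW m hmW]
      exact ((mem_CF.1 (hf W hW)).2.1 m hmW).2.1
    · intro W hW
      exact (mem_CF.1 (hf W hW)).2.congr fun m hm => hglue f W hW m hm
  · intro p hp
    rw [fibF, Finset.mem_filter, mem_allFun] at hp
    funext m
    by_cases hm : m ∈ Finset.Icc 1 n
    · obtain ⟨W, hW, hmW⟩ := hβ3 m hm
      have h2 := hglue (fun W _ m => if m ∈ W then p m else m) W hW m hmW
      simp only [if_pos hmW] at h2
      exact h2
    · have h2 := hglue2 (fun W _ m => if m ∈ W then p m else m) m hm
      exact h2.trans (hp.1.1 m hm).symm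
  · intro f hf
    rw [Finset.mem_pi] at hf
    funext W hW m
    by_cases hm : m ∈ W
    · simp only [if_pos hm]
      exact hglue f W hW m hm
    · simp only [if_neg hm]
      exact ((mem_CF.1 (hf W hW)).1 m hm).symm

theorem card_NFun (n : ℕ) :
    (NFun n).card = ∑ β ∈ NCF n, ∏ W ∈ β, catalan (W.card - 1) := by
  rw [Finset.card_eq_sum_card_fiberwise (f := compPart n) (t := NCF n)
    (fun p hp => compPart_mem hp)]
  apply Finset.sum_congr rfl
  intro β hβ
  rw [fiber_eq n β hβ, card_fibF n β hβ]

/-! ### Linked partitions as parent functions -/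

theorem fmin_mem {A : Finset ℕ} (h : A.Nonempty) : fmin A ∈ A := by
  have := Nat.sInf_mem (s := (A : Set ℕ)) h
  exact this

theorem fmin_le {A : Finset ℕ} {x : ℕ} (h : x ∈ A) : fmin A ≤ x :=
  Nat.sInf_le (s := (A : Set ℕ)) h

theorem fmin_eq {A : Finset ℕ} {a : ℕ} (h : a ∈ A) (h2 : ∀ x ∈ A, a ≤ x) : fmin A = a :=
  le_antisymm (fmin_le h) (h2 _ (fmin_mem ⟨a, h⟩))

/-- The block with minimum `j`. -/
noncomputable def blk (n : ℕ) (p : ℕ → ℕ) (j : ℕ) : Finset ℕ :=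
  insert j ((Finset.Icc 1 n).filter fun m => p m = j)

theorem mem_blk {n : ℕ} {p : ℕ → ℕ} {j x : ℕ} :
    x ∈ blk n p j ↔ x = j ∨ (x ∈ Finset.Icc 1 n ∧ p x = j) := by
  simp [blk]

theorem fmin_blk {n : ℕ} {p : ℕ → ℕ} (hp : ∀ m, p m ≤ m) (j : ℕ) : fmin (blk n p j) = j := by
  apply fmin_eq
  · exact mem_blk.2 (Or.inl rfl)
  · intro x hx
    rcases mem_blk.1 hx with h | ⟨-, h⟩
    · exact h.ge
    · rw [← h]
      exact hp x

/-- The linked partition of a parent function. -/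
noncomputable def toNCL (n : ℕ) (p : ℕ → ℕ) : Finset (Finset ℕ) :=
  ((Finset.Icc 1 n).filter fun j => p j = j ∨ ∃ m ∈ Finset.Icc 1 n, m ≠ j ∧ p m = j).image
    (blk n p)

theorem mem_toNCL {n : ℕ} {p : ℕ → ℕ} {A : Finset ℕ} :
    A ∈ toNCL n p ↔ ∃ j ∈ Finset.Icc 1 n,
      (p j = j ∨ ∃ m ∈ Finset.Icc 1 n, m ≠ j ∧ p m = j) ∧ blk n p j = A := by
  simp only [toNCL, Finset.mem_image, Finset.mem_filter, and_assoc]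

theorem toNCL_mem {n : ℕ} {p : ℕ → ℕ} (hp : p ∈ NFun n) : toNCL n p ∈ NCLF n := by
  rw [mem_NFun] at hp
  obtain ⟨h1, h2, h3, h4⟩ := hp
  have hsub : ∀ V ∈ toNCL n p, V ⊆ Finset.Icc 1 n := by
    intro V hV x hx
    obtain ⟨j, hj, -, rfl⟩ := mem_toNCL.1 hV
    rcases mem_blk.1 hx with rfl | h
    · exact hj
    · exact h.1
  have two : ∀ i x, x ∈ blk n p i → x ≠ i → 2 ≤ (blk n p i).card := by
    intro i x hx hxi
    exact Finset.one_lt_card.2 ⟨x, hx, i, mem_blk.2 (Or.inl rfl), hxi⟩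
  rw [NCLF, Finset.mem_filter]
  refine ⟨?_, ⟨?_, hsub, ?_, ?_⟩, ?_⟩
  · rw [Finset.mem_powerset]
    intro V hV
    exact Finset.mem_powerset.2 (hsub V hV)
  · intro V hV
    obtain ⟨j, hj, -, rfl⟩ := mem_toNCL.1 hV
    exact ⟨j, mem_blk.2 (Or.inl rfl)⟩
  · intro m hm
    by_cases hpm : p m = m
    · exact ⟨blk n p m, mem_toNCL.2 ⟨m, hm, Or.inl hpm, rfl⟩, mem_blk.2 (Or.inl rfl)⟩
    · exact ⟨blk n p (p m), mem_toNCL.2 ⟨p m, h3 m hm, Or.inr ⟨m, hm, Ne.symm hpm, rfl⟩, rfl⟩,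
        mem_blk.2 (Or.inr ⟨hm, rfl⟩)⟩
  · intro A hA B hB hne
    obtain ⟨i, hi, hi2, rfl⟩ := mem_toNCL.1 hA
    obtain ⟨j, hj, hj2, rfl⟩ := mem_toNCL.1 hB
    have hij : i ≠ j := fun h => hne (by rw [h])
    have key : ∀ i j, i ≠ j → (p i = i ∨ ∃ m ∈ Finset.Icc 1 n, m ≠ i ∧ p m = i) →
        i ∈ blk n p j → 2 ≤ (blk n p i).card ∧ 2 ≤ (blk n p j).card ∧ j < i := by
      intro i j hij hi2 hmem
      rcases mem_blk.1 hmem with h | ⟨-, h⟩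
      · exact absurd h hij
      · refine ⟨?_, two j i hmem hij, ?_⟩
        · rcases hi2 with h5 | ⟨m, hm, hmi, hm2⟩
          · omega
          · exact two i m (mem_blk.2 (Or.inr ⟨hm, hm2⟩)) hmi
        · have := h2 i
          omega
    have hx : ∀ x ∈ blk n p i ∩ blk n p j, x = i ∨ x = j := by
      intro x hx
      rw [Finset.mem_inter, mem_blk, mem_blk] at hx
      rcases hx with ⟨h | h, h' | h'⟩
      · exact Or.inl h
      · exact Or.inl h
      · exact Or.inr h'
      · exact absurd (h.2.symm.trans h'.2) hij
    by_cases hemp : blk n p i ∩ blk n p j = ∅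
    · exact Or.inl hemp
    · right
      rw [fmin_blk h2, fmin_blk h2]
      have hiI : i ∈ blk n p i := mem_blk.2 (Or.inl rfl)
      have hjJ : j ∈ blk n p j := mem_blk.2 (Or.inl rfl)
      have hcase : i ∈ blk n p j ∨ j ∈ blk n p i := by
        obtain ⟨x, hxx⟩ := Finset.nonempty_iff_ne_empty.2 hemp
        have hm := Finset.mem_inter.1 hxx
        rcases hx x hxx with rfl | rfl
        · exact Or.inl hm.2
        · exact Or.inr hm.1
      rcases hcase with hc | hc
      · obtain ⟨c1, c2, c3⟩ := key i j hij hi2 hc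
        refine ⟨c1, c2, ?_, hij, hx⟩
        rw [Finset.card_eq_one]
        refine ⟨i, ?_⟩
        ext x
        rw [Finset.mem_singleton]
        constructor
        · intro hxx
          rcases hx x hxx with h | h
          · exact h
          · subst h
            have := key x i (Ne.symm hij) hj2 (Finset.mem_inter.1 hxx).1
            omega
        · rintro rfl
          exact Finset.mem_inter.2 ⟨hiI, hc⟩
      · obtain ⟨c1, c2, c3⟩ := key j i (Ne.symm hij) hj2 hc
        refine ⟨c2, c1, ?_, hij, hx⟩
        rw [Finset.card_eq_one]
        refine ⟨j, ?_⟩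
        ext x
        rw [Finset.mem_singleton]
        constructor
        · intro hxx
          rcases hx x hxx with h | h
          · subst h
            have := key x j hij hi2 (Finset.mem_inter.1 hxx).2
            omega
          · exact h
        · rintro rfl
          exact Finset.mem_inter.2 ⟨hc, hjJ⟩
  · rintro ⟨V, hV, W, hW, hne, a, ha, b, hb, c, hc, d, hd, hab, hbc, hcd⟩
    obtain ⟨i, hi, hi2, rfl⟩ := mem_toNCL.1 hV
    obtain ⟨j, hj, hj2, rfl⟩ := mem_toNCL.1 hW
    have hij : i ≠ j := fun h => hne (by rw [h])
    have e1 := fmin_le ha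
    have e2 := fmin_le hb
    rw [fmin_blk h2] at e1 e2
    rw [mem_blk] at hb hc hd
    have A := h4 c d hcd
    have B := h4 b c hbc
    clear hi2 hj2
    omega

theorem toNCL_parent {n : ℕ} {p : ℕ → ℕ} (hp : p ∈ NFun n) (m j : ℕ) (hj : j < m) :
    p m = j ↔ ∃ A ∈ toNCL n p, m ∈ A ∧ fmin A = j := by
  rw [mem_NFun] at hp
  obtain ⟨h1, h2, h3, h4⟩ := hp
  constructor
  · intro h
    have hm : m ∈ Finset.Icc 1 n := by
      by_contra hm
      have := h1 m hm
      omega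
    exact ⟨blk n p j, mem_toNCL.2 ⟨j, h ▸ h3 m hm, Or.inr ⟨m, hm, by omega, h⟩, rfl⟩,
      mem_blk.2 (Or.inr ⟨hm, h⟩), fmin_blk h2 j⟩
  · rintro ⟨A, hA, hmA, hfA⟩
    obtain ⟨i, hi, hi2, rfl⟩ := mem_toNCL.1 hA
    rw [fmin_blk h2] at hfA
    rcases mem_blk.1 hmA with h | h
    · omega
    · rw [h.2, hfA]

theorem toNCL_inj {n : ℕ} {p q : ℕ → ℕ} (hp : p ∈ NFun n) (hq : q ∈ NFun n)
    (h : toNCL n p = toNCL n q) : p = q := by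
  have hiff : ∀ m j, j < m → (p m = j ↔ q m = j) := by
    intro m j hj
    rw [toNCL_parent hp m j hj, toNCL_parent hq m j hj, h]
  have hp2 := (mem_NFun.1 hp).2.1
  have hq2 := (mem_NFun.1 hq).2.1
  funext m
  rcases (hp2 m).lt_or_eq with h1 | h1
  · exact ((hiff m _ h1).1 rfl).symm
  · rcases (hq2 m).lt_or_eq with h3 | h3
    · exact (hiff m _ h3).2 rfl
    · rw [h1, h3]

theorem toNCL_surj {n : ℕ} {π : Finset (Finset ℕ)} (hπ : π ∈ NCLF n) :
    ∃ p ∈ NFun n, toNCL n p = π := by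
  rw [NCLF, Finset.mem_filter] at hπ
  obtain ⟨-, ⟨h1, h2, h3, h4⟩, h5⟩ := hπ
  have hmin : ∀ A ∈ π, fmin A ∈ A := fun A hA => fmin_mem (h1 A hA)
  -- blocks are determined by their minimum
  have uniqMin : ∀ A ∈ π, ∀ B ∈ π, fmin A = fmin B → A = B := by
    intro A hA B hB h
    by_contra hne
    rcases h4 A hA B hB hne with h6 | h6
    · have : fmin A ∈ A ∩ B := Finset.mem_inter.2 ⟨hmin A hA, h ▸ hmin B hB⟩
      rw [h6] at this
      simp at this
    · exact h6.2.2.2.1 h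
  -- an element is non-minimal in at most one block
  have uniqNon : ∀ A ∈ π, ∀ B ∈ π, ∀ x, x ∈ A → x ∈ B → fmin A < x → fmin B < x → A = B := by
    intro A hA B hB x hxA hxB hx1 hx2
    by_contra hne
    have hx : x ∈ A ∩ B := Finset.mem_inter.2 ⟨hxA, hxB⟩
    rcases h4 A hA B hB hne with h6 | h6
    · rw [h6] at hx
      simp at hx
    · rcases h6.2.2.2.2 x hx with h7 | h7 <;> omega
  let p : ℕ → ℕ := fun m =>
    if h : ∃ A, A ∈ π ∧ m ∈ A ∧ fmin A < m then fmin h.choose else m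
  have hpA : ∀ A ∈ π, ∀ m ∈ A, fmin A < m → p m = fmin A := by
    intro A hA m hm hlt
    have h : ∃ A, A ∈ π ∧ m ∈ A ∧ fmin A < m := ⟨A, hA, hm, hlt⟩
    have hg : p m = fmin h.choose := dif_pos h
    have hs := h.choose_spec
    rw [hg, uniqNon _ hs.1 A hA m hs.2.1 hm hs.2.2 hlt]
  have hpcase : ∀ m, (∃ A ∈ π, m ∈ A ∧ fmin A < m ∧ p m = fmin A) ∨
      (p m = m ∧ ∀ A ∈ π, m ∈ A → fmin A = m) := by
    intro m
    by_cases h : ∃ A, A ∈ π ∧ m ∈ A ∧ fmin A < m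
    · obtain ⟨A, hA, hm, hlt⟩ := h
      exact Or.inl ⟨A, hA, hm, hlt, hpA A hA m hm hlt⟩
    · refine Or.inr ⟨dif_neg h, fun A hA hm => ?_⟩
      have := fmin_le hm
      by_contra hne
      exact h ⟨A, hA, hm, by omega⟩
  have hle : ∀ m, p m ≤ m := by
    intro m
    rcases hpcase m with ⟨A, hA, hm, hlt, h⟩ | ⟨h, -⟩ <;> omega
  have hblk : ∀ A ∈ π, blk n p (fmin A) = A := by
    intro A hA
    ext x
    rw [mem_blk]
    constructor
    · rintro (rfl | ⟨hx, hpx⟩)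
      · exact hmin A hA
      · rcases hpcase x with ⟨B, hB, hm, hlt, h⟩ | ⟨h, -⟩
        · rw [uniqMin A hA B hB (hpx.symm.trans h)]
          exact hm
        · rw [← h, hpx]
          exact hmin A hA
    · intro hx
      rcases (fmin_le hx).lt_or_eq with hlt | heq
      · exact Or.inr ⟨h2 A hA hx, hpA A hA x hx hlt⟩
      · exact Or.inl heq.symm
  refine ⟨p, mem_NFun.2 ⟨?_, hle, ?_, ?_⟩, ?_⟩
  · intro m hm
    rcases hpcase m with ⟨A, hA, hmA, -, -⟩ | ⟨h, -⟩
    · exact absurd (h2 A hA hmA) hm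
    · exact h
  · intro m hm
    rcases hpcase m with ⟨A, hA, hmA, -, h⟩ | ⟨h, -⟩
    · rw [h]
      exact h2 A hA (hmin A hA)
    · rw [h]
      exact hm
  · rintro x y hxy ⟨h6, h7⟩
    rcases hpcase x with ⟨A, hA, hxA, hlt, h⟩ | ⟨h, -⟩
    · rcases hpcase y with ⟨B, hB, hyB, hlt', h'⟩ | ⟨h', -⟩
      · refine h5 ⟨A, hA, B, hB, ?_, fmin A, hmin A hA, fmin B, hmin B hB, x, hxA, y, hyB, ?_⟩
        · rintro rfl
          omega
        · omega
      · omega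
    · omega
  · ext A
    rw [mem_toNCL]
    constructor
    · rintro ⟨j, hj, hj2, rfl⟩
      have : ∃ A ∈ π, fmin A = j := by
        rcases hj2 with h | ⟨m, hm, hmj, hpm⟩
        · rcases hpcase j with ⟨A, hA, hjA, hlt, h'⟩ | ⟨-, h'⟩
          · omega
          · obtain ⟨A, hA, hjA⟩ := h3 j hj
            exact ⟨A, hA, h' A hA hjA⟩
        · rcases hpcase m with ⟨A, hA, hmA, hlt, h'⟩ | ⟨h', -⟩
          · exact ⟨A, hA, h'.symm.trans hpm⟩
          · omega
      obtain ⟨A, hA, rfl⟩ := this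
      rw [hblk A hA]
      exact hA
    · intro hA
      refine ⟨fmin A, h2 A hA (hmin A hA), ?_, hblk A hA⟩
      by_cases hex : ∃ m ∈ A, m ≠ fmin A
      · obtain ⟨m, hm, hne⟩ := hex
        have := fmin_le hm
        exact Or.inr ⟨m, h2 A hA hm, hne, hpA A hA m hm (by omega)⟩
      · left
        rcases hpcase (fmin A) with ⟨B, hB, hmB, hlt, h⟩ | ⟨h, -⟩
        · exfalso
          have hAB : A ≠ B := by
            rintro rfl
            omega
          rcases h4 A hA B hB hAB with h6 | h6
          · have : fmin A ∈ A ∩ B := Finset.mem_inter.2 ⟨hmin A hA, hmB⟩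
            rw [h6] at this
            simp at this
          · obtain ⟨a, ha, b, hb, hab⟩ := Finset.one_lt_card.1 h6.1
            by_cases haf : a = fmin A
            · exact hex ⟨b, hb, fun hbf => hab (haf.trans hbf.symm)⟩
            · exact hex ⟨a, ha, haf⟩
        · exact h

theorem card_NCLF (n : ℕ) : (NCLF n).card = (NFun n).card := by
  symm
  refine Finset.card_bij (fun p _ => toNCL n p) (fun p hp => toNCL_mem hp)
    (fun p hp q hq h => toNCL_inj hp hq h) ?_
  intro π hπ
  obtain ⟨p, hp, h⟩ := toNCL_surj hπ
  exact ⟨p, hp, h⟩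

/-- For every positive integer `n`,
`|NCL(n)| = Σ_{β ∈ NC(n)} ∏_{W block of β} Cat_{|W| - 1}`. -/
theorem stmt11 (n : ℕ) (hn : 0 < n) :
    (NCLF n).card = ∑ β ∈ NCF n, ∏ W ∈ β, catalan (W.card - 1) := by
  rw [card_NCLF, card_NFun]
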